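/- Let Λ be a finitely aligned k-graph and suppose x : Ω_{k,d(x)} → Λ is an aperiodic graph morphism. Suppose λ ≠ μ are paths with s(λ) = s(μ) = r(x). Then there exists n ∈ ℕ^k with n ≤ d(x) such that Λ^min(λ·x(0,n), μ·x(0,n)) = ∅. -/

import Mathlib

open scoped ENNReal

attribute [local instance] Classical.propDecidable

/-- Product of `f` over a set `S`, in some arbitrary order (junk value `1` if `S` is
infinite).  Used for products of commuting projections. -/
noncomputable def listProd {ι A : Type*} [Monoid A] (S : Set ι) (f : ι → A) : A :=
  if h : S.Finite then (h.toFinset.toList.map f).prod else 1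

/-- A `k`-graph: a countable category `Λ` (whose morphisms are the terms of `Path`, with
vertices identified with the morphisms of degree `0`) together with a degree functor
`d : Λ → ℕ^k` satisfying the factorisation property. -/
structure KGraph (k : ℕ) where
  Path : Type
  countable : Countable Path
  d : Path → Fin k → ℕ
  r : Path → Path
  s : Path → Path
  comp : Path → Path → Path
  d_r : ∀ lam, d (r lam) = 0
  d_s : ∀ lam, d (s lam) = 0
  r_r : ∀ lam, r (r lam) = r lam
  s_r : ∀ lam, s (r lam) = r lam
  r_s : ∀ lam, r (s lam) = s lam
  s_s : ∀ lam, s (s lam) = s lam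
  comp_source : ∀ lam, comp lam (s lam) = lam
  range_comp : ∀ lam, comp (r lam) lam = lam
  r_comp : ∀ lam mu, s lam = r mu → r (comp lam mu) = r lam
  s_comp : ∀ lam mu, s lam = r mu → s (comp lam mu) = s mu
  d_comp : ∀ lam mu, s lam = r mu → d (comp lam mu) = d lam + d mu
  comp_assoc : ∀ lam mu nu, s lam = r mu → s mu = r nu →
    comp (comp lam mu) nu = comp lam (comp mu nu)
  factor : ∀ lam m n, d lam = m + n →
    ∃! p : Path × Path, s p.1 = r p.2 ∧ d p.1 = m ∧ d p.2 = n ∧ comp p.1 p.2 = lam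

namespace KGraph

variable {k : ℕ} (Λ : KGraph k)

/-- Vertices are identified with the paths of degree `0`. -/
def IsVertex (v : Λ.Path) : Prop := Λ.d v = 0

/-- The unique factorisation of `lam` as a product of a path of degree `m` and the
remaining tail (junk value if `¬ m ≤ d lam`). -/
noncomputable def split (lam : Λ.Path) (m : Fin k → ℕ) : Λ.Path × Λ.Path :=
  if h : m ≤ Λ.d lam then
    (Λ.factor lam m (Λ.d lam - m) (by
      funext i
      exact (Nat.add_sub_cancel' (h i)).symm)).choose
  else (lam, lam)

/-- The segment `λ(m,n)` of the path `λ`: the unique path of degree `n - m` such that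
`λ = λ(0,m) λ(m,n) λ(n, d λ)` (meaningful for `m ≤ n ≤ d λ`). -/
noncomputable def seg (lam : Λ.Path) (m n : Fin k → ℕ) : Λ.Path :=
  (Λ.split (Λ.split lam n).1 m).2

/-- `MCE(μ,ν)`: minimal common extensions of `μ` and `ν`. -/
def MCE (mu nu : Λ.Path) : Set Λ.Path :=
  {lam | Λ.d lam = Λ.d mu ⊔ Λ.d nu ∧ Λ.seg lam 0 (Λ.d mu) = mu ∧ Λ.seg lam 0 (Λ.d nu) = nu}

/-- `Λ^min(μ,ν) = {(α,β) : μα = νβ ∈ MCE(μ,ν)}`. -/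
def Lmin (mu nu : Λ.Path) : Set (Λ.Path × Λ.Path) :=
  {p | Λ.s mu = Λ.r p.1 ∧ Λ.s nu = Λ.r p.2 ∧ Λ.comp mu p.1 = Λ.comp nu p.2 ∧
    Λ.comp mu p.1 ∈ Λ.MCE mu nu}

/-- `Ext(μ;E)`: extensions of `μ` with respect to `E`. -/
def Ext (mu : Λ.Path) (E : Set Λ.Path) : Set Λ.Path :=
  {a | Λ.r a = Λ.s mu ∧ ∃ nu ∈ E, ∃ b, (a, b) ∈ Λ.Lmin mu nu}

/-- `Λ` is finitely aligned if all the sets `MCE(μ,ν)` are finite. -/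
def FinitelyAligned : Prop := ∀ mu nu, (Λ.MCE mu nu).Finite

/-- `E ⊆ vΛ` is exhaustive if `Ext(λ;E) ≠ ∅` for all `λ ∈ vΛ`. -/
def Exhaustive (v : Λ.Path) (E : Set Λ.Path) : Prop :=
  ∀ lam, Λ.r lam = v → (Λ.Ext lam E).Nonempty

/-- `E ∈ vFE(Λ)`: `E ⊆ vΛ \ {v}` is finite and exhaustive (so `r(E) = v`). -/
def FEat (v : Λ.Path) (E : Set Λ.Path) : Prop :=
  Λ.IsVertex v ∧ (∀ lam ∈ E, Λ.r lam = v ∧ lam ≠ v) ∧ E.Finite ∧ Λ.Exhaustive v E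

/-- `FE(Λ)`: the finite exhaustive sets. -/
def FE : Set (Set Λ.Path) := {E | ∃ v, Λ.FEat v E}

/-- `λE = {λμ : μ ∈ E, r(μ) = s(λ)}`. -/
def lamSet (lam : Λ.Path) (E : Set Λ.Path) : Set Λ.Path :=
  {x | ∃ mu ∈ E, Λ.s lam = Λ.r mu ∧ Λ.comp lam mu = x}

/-- `EΛ = {λμ : λ ∈ E, r(μ) = s(λ)}`. -/
def setLam (E : Set Λ.Path) : Set Λ.Path :=
  {x | ∃ lam ∈ E, ∃ mu, Λ.s lam = Λ.r mu ∧ Λ.comp lam mu = x}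

/-- `𝓔 ⊆ FE(Λ)` is satiated if it satisfies (S1)--(S4). -/
def Satiated (𝓔 : Set (Set Λ.Path)) : Prop :=
  𝓔 ⊆ Λ.FE ∧
  (∀ G ∈ 𝓔, ∀ E ∈ Λ.FE, G ⊆ E → E ∈ 𝓔) ∧
  (∀ G ∈ 𝓔, ∀ v, Λ.FEat v G → ∀ mu, Λ.r mu = v → mu ∉ Λ.setLam G → Λ.Ext mu G ∈ 𝓔) ∧
  (∀ G ∈ 𝓔, ∀ n : Λ.Path → Fin k → ℕ, (∀ lam ∈ G, 0 < n lam ∧ n lam ≤ Λ.d lam) →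
    ((fun lam => Λ.seg lam 0 (n lam)) '' G) ∈ 𝓔) ∧
  (∀ G ∈ 𝓔, ∀ G' ⊆ G, ∀ Gl : Λ.Path → Set Λ.Path,
    (∀ lam ∈ G', Gl lam ∈ 𝓔 ∧ Λ.FEat (Λ.s lam) (Gl lam)) →
    ((G \ G') ∪ ⋃ lam ∈ G', Λ.lamSet lam (Gl lam)) ∈ 𝓔)

/-- The satiation `𝓔̄` of `𝓔`: the smallest satiated subset of `FE(Λ)` containing `𝓔`. -/
def satiation (𝓔 : Set (Set Λ.Path)) : Set (Set Λ.Path) :=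
  ⋂₀ {F | 𝓔 ⊆ F ∧ Λ.Satiated F}

/-- `ΠE`: the smallest subset of `Λ` containing `E` which is closed under the operation
`(λ,μ,σ) ↦ λ Ext(μ;{σ})` for `λ,μ,σ ∈ ΠE` with `d(λ) = d(μ)`, `s(λ) = s(μ)`. -/
def PiSet (E : Set Λ.Path) : Set Λ.Path :=
  ⋂₀ {G | E ⊆ G ∧ ∀ lam mu sig, lam ∈ G → mu ∈ G → sig ∈ G →
    Λ.d lam = Λ.d mu → Λ.s lam = Λ.s mu → Λ.lamSet lam (Λ.Ext mu {sig}) ⊆ G}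

/-- `Σ₁(𝓔)`: finite sets `F ⊆ r(E)Λ \ Λ⁰` containing some `E ∈ 𝓔`. -/
def Sig1 (𝓔 : Set (Set Λ.Path)) : Set (Set Λ.Path) :=
  {F | ∃ E ∈ 𝓔, ∃ v, Λ.FEat v E ∧ E ⊆ F ∧ F.Finite ∧
    ∀ lam ∈ F, Λ.r lam = v ∧ ¬ Λ.IsVertex lam}

/-- `Σ₂(𝓔) = {Ext(μ;E) : E ∈ 𝓔, μ ∈ r(E)Λ \ EΛ}`. -/
def Sig2 (𝓔 : Set (Set Λ.Path)) : Set (Set Λ.Path) :=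
  {F | ∃ E ∈ 𝓔, ∃ v, Λ.FEat v E ∧ ∃ mu, Λ.r mu = v ∧ mu ∉ Λ.setLam E ∧ F = Λ.Ext mu E}

/-- `Σ₃(𝓔) = {{λ(0,n_λ) : λ ∈ E} : E ∈ 𝓔, 0 < n_λ ≤ d(λ)}`. -/
def Sig3 (𝓔 : Set (Set Λ.Path)) : Set (Set Λ.Path) :=
  {F | ∃ E ∈ 𝓔, ∃ n : Λ.Path → Fin k → ℕ, (∀ lam ∈ E, 0 < n lam ∧ n lam ≤ Λ.d lam) ∧
    F = (fun lam => Λ.seg lam 0 (n lam)) '' E}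

/-- `Σ₄(𝓔) = {(E \ F) ∪ ⋃_{λ ∈ F} λ F_λ : E ∈ 𝓔, F ⊆ E, F_λ ∈ s(λ)𝓔}`. -/
def Sig4 (𝓔 : Set (Set Λ.Path)) : Set (Set Λ.Path) :=
  {G | ∃ E ∈ 𝓔, ∃ F ⊆ E, ∃ Fl : Λ.Path → Set Λ.Path,
    (∀ lam ∈ F, Fl lam ∈ 𝓔 ∧ Λ.FEat (Λ.s lam) (Fl lam)) ∧
    G = (E \ F) ∪ ⋃ lam ∈ F, Λ.lamSet lam (Fl lam)}

/-- `Σ = Σ₄ ∘ Σ₃ ∘ Σ₂ ∘ Σ₁`. -/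
def SigmaStep (𝓔 : Set (Set Λ.Path)) : Set (Set Λ.Path) :=
  Λ.Sig4 (Λ.Sig3 (Λ.Sig2 (Λ.Sig1 𝓔)))

/-- `Σ^∞(𝓔) = ⋃_{n ≥ 1} Σ^n(𝓔)`. -/
def SigmaInf (𝓔 : Set (Set Λ.Path)) : Set (Set Λ.Path) :=
  ⋃ n : ℕ, (Λ.SigmaStep)^[n + 1] 𝓔

section StarAlgebra

variable {A : Type*} [Ring A] [StarRing A]

/-- The product `∏_{λ ∈ E} (t_v - t_λ t_λ*)` (the factors pairwise commute for any
family satisfying (TCK1)--(TCK3), so the implicit choice of ordering is immaterial). -/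
noncomputable def gapProd (t : Λ.Path → A) (v : Λ.Path) (E : Set Λ.Path) : A :=
  listProd E fun lam => t v - t lam * star (t lam)

/-- Conditions (TCK1)--(TCK3) on a family `{t_λ}`. -/
def TCKFamily (t : Λ.Path → A) : Prop :=
  (∀ v, Λ.IsVertex v → star (t v) = t v ∧ t v * t v = t v) ∧
  (∀ v w, Λ.IsVertex v → Λ.IsVertex w → v ≠ w → t v * t w = 0) ∧
  (∀ lam mu, Λ.s lam = Λ.r mu → t lam * t mu = t (Λ.comp lam mu)) ∧
  (∀ lam mu, star (t lam) * t mu = ∑ᶠ p ∈ Λ.Lmin lam mu, t p.1 * star (t p.2))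

/-- A relative Cuntz-Krieger `(Λ;𝓔)`-family: (TCK1)--(TCK3) together with (CK). -/
def RCKFamily (𝓔 : Set (Set Λ.Path)) (t : Λ.Path → A) : Prop :=
  Λ.TCKFamily t ∧ ∀ E ∈ 𝓔, ∀ v, Λ.FEat v E → Λ.gapProd t v E = 0

/-- `Θ(t)^{ΠE}_{λ,μ} = t_λ (∏_{λν ∈ ΠE, d(ν) > 0} (t_{s(λ)} - t_ν t_ν*)) t_μ*`. -/
noncomputable def Theta (t : Λ.Path → A) (E : Set Λ.Path) (lam mu : Λ.Path) : A :=
  t lam *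
    listProd {nu | Λ.s lam = Λ.r nu ∧ ¬ Λ.IsVertex nu ∧ Λ.comp lam nu ∈ Λ.PiSet E}
      (fun nu => t (Λ.s lam) - t nu * star (t nu)) *
    star (t mu)

end StarAlgebra

end KGraph

/-- A graph morphism `x : Ω_{k,m} → Λ`, encoded by its length `m = d(x) ∈ (ℕ∪{∞})^k`
and its values `x(p,q)` on the morphisms `(p,q)` of `Ω_{k,m}` (with the junk value
`x(0,0)` outside the meaningful domain, so graph morphisms are extensional). -/
structure GMor {k : ℕ} (Λ : KGraph k) where
  len : Fin k → ℕ∞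
  seg : (Fin k → ℕ) → (Fin k → ℕ) → Λ.Path
  d_seg : ∀ p q, p ≤ q → (∀ i, (q i : ℕ∞) ≤ len i) → Λ.d (seg p q) = q - p
  r_seg : ∀ p q, p ≤ q → (∀ i, (q i : ℕ∞) ≤ len i) → Λ.r (seg p q) = seg p p
  s_seg : ∀ p q, p ≤ q → (∀ i, (q i : ℕ∞) ≤ len i) → Λ.s (seg p q) = seg q q
  comp_seg : ∀ p q u, p ≤ q → q ≤ u → (∀ i, (u i : ℕ∞) ≤ len i) →
    Λ.comp (seg p q) (seg q u) = seg p u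
  seg_junk : ∀ p q, ¬ (p ≤ q ∧ ∀ i, (q i : ℕ∞) ≤ len i) → seg p q = seg 0 0

namespace GMor

variable {k : ℕ} {Λ : KGraph k}

/-- The range `r(x) = x(0)` of a graph morphism. -/
def range (x : GMor Λ) : Λ.Path := x.seg 0 0

/-- `y = x|_n^{d(x)}`, the restriction of `x` (defined for `n ≤ d(x)`):
`d(y) = d(x) - n` and `y(p,q) = x(n+p, n+q)`. -/
def IsRestriction (y x : GMor Λ) (n : Fin k → ℕ) : Prop :=
  (∀ i, y.len i = x.len i - (n i : ℕ∞)) ∧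
  ∀ p q, p ≤ q → (∀ i, (q i : ℕ∞) ≤ y.len i) → y.seg p q = x.seg (n + p) (n + q)

/-- `y = λx`, the extension of `x` by `λ ∈ Λ r(x)`: `d(y) = d(λ) + d(x)`,
`y(0, d(λ)) = λ` and `y(d(λ), d(λ)+n) = x(0,n)` for `n ≤ d(x)`. -/
def IsExtension (y : GMor Λ) (lam : Λ.Path) (x : GMor Λ) : Prop :=
  (∀ i, y.len i = (Λ.d lam i : ℕ∞) + x.len i) ∧
  y.seg 0 (Λ.d lam) = lam ∧
  ∀ n : Fin k → ℕ, (∀ i, (n i : ℕ∞) ≤ x.len i) →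
    y.seg (Λ.d lam) (Λ.d lam + n) = x.seg 0 n

/-- `x ∈ FΛ^∞`: `x` has an initial segment belonging to `F`. -/
def HasInit (x : GMor Λ) (F : Set Λ.Path) : Prop :=
  ∃ lam ∈ F, (∀ i, (Λ.d lam i : ℕ∞) ≤ x.len i) ∧ x.seg 0 (Λ.d lam) = lam

/-- `z` restricts to `x` on `Ω_{k, d(x)}`. -/
def Agrees (z x : GMor Λ) : Prop :=
  ∀ p q, p ≤ q → (∀ i, (q i : ℕ∞) ≤ x.len i) → z.seg p q = x.seg p q

/-- `z ∈ MCE(x,y)` for graph morphisms `x, y`. -/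
def IsMCE (z x y : GMor Λ) : Prop :=
  (∀ i, z.len i = max (x.len i) (y.len i)) ∧ z.Agrees x ∧ z.Agrees y

/-- `x` is aperiodic: for distinct `λ, μ ∈ Λ r(x)`, `MCE(λx, μx) = ∅`. -/
def Aperiodic (x : GMor Λ) : Prop :=
  ∀ lam mu : Λ.Path, lam ≠ mu → Λ.s lam = x.range → Λ.s mu = x.range →
    ∀ lx mx : GMor Λ, lx.IsExtension lam x → mx.IsExtension mu x →
      ∀ z : GMor Λ, ¬ z.IsMCE lx mx

end GMor

namespace KGraph

variable {k : ℕ} (Λ : KGraph k)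

/-- `x ∈ ∂(Λ;𝓔)`: an `𝓔`-compatible boundary path. -/
def IsBdry (𝓔 : Set (Set Λ.Path)) (x : GMor Λ) : Prop :=
  ∀ n : Fin k → ℕ, (∀ i, (n i : ℕ∞) ≤ x.len i) →
    ∀ E ∈ 𝓔, Λ.FEat (x.seg n n) E →
      ∃ lam ∈ E, (∀ i, ((n + Λ.d lam) i : ℕ∞) ≤ x.len i) ∧ x.seg n (n + Λ.d lam) = lam

/-- Condition (C): aperiodic `𝓔`-compatible boundary paths out of every vertex, and
avoiding any given `F ∈ vFE(Λ) \ 𝓔`. -/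
def CondC (𝓔 : Set (Set Λ.Path)) : Prop :=
  (∀ v, Λ.IsVertex v → ∃ x : GMor Λ, Λ.IsBdry 𝓔 x ∧ x.range = v ∧ x.Aperiodic) ∧
  (∀ v F, Λ.FEat v F → F ∉ 𝓔 →
    ∃ x : GMor Λ, Λ.IsBdry 𝓔 x ∧ x.range = v ∧ ¬ x.HasInit F ∧ x.Aperiodic)

end KGraph

namespace KGraph

variable {k : ℕ} {Λ : KGraph k}

/-- `a` is an initial segment of `b`. -/
def IsPrefix (Λ : KGraph k) (a b : Λ.Path) : Prop :=
  ∃ t, Λ.s a = Λ.r t ∧ Λ.comp a t = b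

lemma factor_unique {a b a' b' : Λ.Path} (h : Λ.s a = Λ.r b) (h' : Λ.s a' = Λ.r b')
    (hd : Λ.d a = Λ.d a') (hc : Λ.comp a b = Λ.comp a' b') : a = a' ∧ b = b' := by
  have hb : Λ.d b' = Λ.d b := by
    have e := congrArg Λ.d hc
    rw [Λ.d_comp _ _ h, Λ.d_comp _ _ h', hd] at e
    exact (add_left_cancel e).symm
  have := (Λ.factor (Λ.comp a b) (Λ.d a) (Λ.d b) (Λ.d_comp _ _ h)).unique
    (y₁ := (a, b)) (y₂ := (a', b')) ⟨h, rfl, rfl, rfl⟩ ⟨h', hd.symm, hb, hc.symm⟩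
  simpa using this

lemma comp_left_cancel {a b b' : Λ.Path} (h : Λ.s a = Λ.r b) (h' : Λ.s a = Λ.r b')
    (hc : Λ.comp a b = Λ.comp a b') : b = b' :=
  (factor_unique h h' rfl hc).2

lemma comp_of_d_eq_zero {a b : Λ.Path} (ha : Λ.d a = 0) (h : Λ.s a = Λ.r b) :
    Λ.comp a b = b := by
  have e : Λ.r a = a :=
    (factor_unique (a := Λ.r a) (b := a) (a' := a) (b' := Λ.s a) (Λ.s_r a) (Λ.r_s a).symm
      (by rw [Λ.d_r, ha]) (by rw [Λ.range_comp, Λ.comp_source])).1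
  have e' : a = Λ.r b := by rw [← h, ← e, Λ.s_r]
  rw [e', Λ.range_comp]

lemma IsPrefix.d_le {a b : Λ.Path} (h : Λ.IsPrefix a b) : Λ.d a ≤ Λ.d b := by
  obtain ⟨t, ht, rfl⟩ := h
  rw [Λ.d_comp _ _ ht]
  exact le_self_add

lemma IsPrefix.trans {a b c : Λ.Path} (h : Λ.IsPrefix a b) (h' : Λ.IsPrefix b c) :
    Λ.IsPrefix a c := by
  obtain ⟨t, ht, rfl⟩ := h
  obtain ⟨u, hu, rfl⟩ := h'
  rw [Λ.s_comp _ _ ht] at hu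
  exact ⟨Λ.comp t u, by rw [Λ.r_comp _ _ hu, ht], (Λ.comp_assoc _ _ _ ht hu).symm⟩

lemma IsPrefix.eq_of_d_eq {a b c : Λ.Path} (ha : Λ.IsPrefix a c) (hb : Λ.IsPrefix b c)
    (hd : Λ.d a = Λ.d b) : a = b := by
  obtain ⟨t, ht, rfl⟩ := ha
  obtain ⟨u, hu, hc⟩ := hb
  exact (factor_unique ht hu hd hc.symm).1

lemma IsPrefix.refl (a : Λ.Path) : Λ.IsPrefix a a :=
  ⟨Λ.s a, (Λ.r_s a).symm, Λ.comp_source a⟩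

lemma split_spec (a : Λ.Path) {m : Fin k → ℕ} (h : m ≤ Λ.d a) :
    Λ.s (Λ.split a m).1 = Λ.r (Λ.split a m).2 ∧ Λ.d (Λ.split a m).1 = m ∧
      Λ.comp (Λ.split a m).1 (Λ.split a m).2 = a := by
  have e := (Λ.factor a m (Λ.d a - m) (by
      funext i
      exact (Nat.add_sub_cancel' (h i)).symm)).choose_spec.1
  rw [split, dif_pos h]
  exact ⟨e.1, e.2.1, e.2.2.2⟩

lemma isPrefix_split (a : Λ.Path) {m : Fin k → ℕ} (h : m ≤ Λ.d a) :
    Λ.IsPrefix (Λ.split a m).1 a :=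
  ⟨_, (split_spec a h).1, (split_spec a h).2.2⟩

lemma IsPrefix.split_eq {a b : Λ.Path} (h : Λ.IsPrefix a b) : (Λ.split b (Λ.d a)).1 = a :=
  (isPrefix_split b h.d_le).eq_of_d_eq h (split_spec b h.d_le).2.1

lemma IsPrefix.of_d_le {a b c : Λ.Path} (ha : Λ.IsPrefix a c) (hb : Λ.IsPrefix b c)
    (hd : Λ.d a ≤ Λ.d b) : Λ.IsPrefix a b := by
  have e := ((isPrefix_split b hd).trans hb).eq_of_d_eq ha (split_spec b hd).2.1
  exact e ▸ isPrefix_split b hd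

lemma IsPrefix.seg_eq {a b : Λ.Path} (h : Λ.IsPrefix a b) : Λ.seg b 0 (Λ.d a) = a := by
  rw [seg, h.split_eq]
  obtain ⟨h1, h2, h3⟩ := split_spec a zero_le
  rw [← comp_of_d_eq_zero h2 h1, h3]

/-- A coherent choice of paths along a projective system of finite nonempty sets of paths. -/
lemma exists_coherent_paths (L : Fin k → ℕ∞) (D : Fin k → ℕ) (S : (Fin k → ℕ) → Set Λ.Path)
    (hd : ∀ n, ∀ a ∈ S n, Λ.d a = D + n) (hfin : ∀ n, (S n).Finite)
    (hne : ∀ n : Fin k → ℕ, (∀ i, (n i : ℕ∞) ≤ L i) → (S n).Nonempty)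
    (hres : ∀ m n, m ≤ n → ∀ a b, b ∈ S n → Λ.IsPrefix a b → Λ.d a = D + m → a ∈ S m) :
    ∃ Z : (Fin k → ℕ) → Λ.Path,
      (∀ n : Fin k → ℕ, (∀ i, (n i : ℕ∞) ≤ L i) → Z n ∈ S n) ∧
      ∀ m n : Fin k → ℕ, m ≤ n → (∀ i, (n i : ℕ∞) ≤ L i) → Λ.IsPrefix (Z m) (Z n) := by
  let J := {n : Fin k → ℕ // ∀ i, (n i : ℕ∞) ≤ L i}
  have : IsDirectedOrder J := ⟨fun a b => ⟨⟨a.1 ⊔ b.1, fun i => by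
    rcases le_total (a.1 i) (b.1 i) with h | h
    · simpa [h] using b.2 i
    · simpa [h] using a.2 i⟩, (le_sup_left : a.1 ≤ a.1 ⊔ b.1),
      (le_sup_right : b.1 ≤ a.1 ⊔ b.1)⟩⟩
  have : Nonempty J := ⟨⟨0, fun i => by simp⟩⟩
  have hle : ∀ {m n : Fin k → ℕ}, m ≤ n → ∀ b ∈ S n, D + m ≤ Λ.d b := by
    intro m n hmn b hb
    rw [hd n b hb]
    exact add_le_add_right hmn D
  let F : CategoryTheory.Functor Jᵒᵖ Type :=
    { obj := fun n => S n.unop.1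
      map := fun {n m} f => TypeCat.ofHom fun b =>
        ⟨(Λ.split b.1 (D + m.unop.1)).1,
          have h := hle (show m.unop.1 ≤ n.unop.1 from f.unop.le) b.1 b.2
          hres _ _ f.unop.le _ _ b.2 (isPrefix_split _ h) (split_spec _ h).2.1⟩
      map_id := by
        intro n
        ext b
        show (Λ.split b.1 (D + n.unop.1)).1 = b.1
        rw [← hd _ _ b.2]
        exact (IsPrefix.refl b.1).split_eq
      map_comp := by
        intro n m l f g
        ext b
        show (Λ.split b.1 (D + l.unop.1)).1 =
          (Λ.split (Λ.split b.1 (D + m.unop.1)).1 (D + l.unop.1)).1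
        have hml : l.unop.1 ≤ m.unop.1 := g.unop.le
        have hnm : m.unop.1 ≤ n.unop.1 := f.unop.le
        have h1 := hle hnm b.1 b.2
        have h2 := hle (hml.trans hnm) b.1 b.2
        have h3 : D + l.unop.1 ≤ Λ.d (Λ.split b.1 (D + m.unop.1)).1 := by
          rw [(split_spec _ h1).2.1]
          exact add_le_add_right hml D
        exact (isPrefix_split _ h2).eq_of_d_eq
          ((isPrefix_split _ h3).trans (isPrefix_split _ h1))
          (by rw [(split_spec _ h2).2.1, (split_spec _ h3).2.1]) }
  have : ∀ j, Finite (F.obj j) := fun j => (hfin j.unop.1).to_subtype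
  have : ∀ j, Nonempty (F.obj j) := fun j => (hne j.unop.1 j.unop.2).to_subtype
  obtain ⟨u, hu⟩ := nonempty_sections_of_finite_inverse_system F
  have huS : ∀ n : J, (u (.op n)).1 ∈ S n.1 := fun n => (u (.op n)).2
  have huP : ∀ m n : J, m ≤ n → Λ.IsPrefix (u (.op m)).1 (u (.op n)).1 := by
    intro m n hmn
    have e : (Λ.split (u (.op n)).1 (D + m.1)).1 = (u (.op m)).1 :=
      congrArg Subtype.val (hu (CategoryTheory.homOfLE hmn).op)
    rw [← e]
    exact isPrefix_split _ (hle hmn _ (huS n))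
  refine ⟨fun n => if h : ∀ i, (n i : ℕ∞) ≤ L i then (u (.op ⟨n, h⟩)).1
    else (u (.op ⟨0, fun i => by simp⟩)).1, ?_, ?_⟩
  · intro n hn
    simp only [dif_pos hn]
    exact huS ⟨n, hn⟩
  · intro m n hmn hn
    have hm : ∀ i, (m i : ℕ∞) ≤ L i :=
      fun i => (Nat.cast_le.2 (hmn i)).trans (hn i)
    simp only [dif_pos hn, dif_pos hm]
    exact huP ⟨m, hm⟩ ⟨n, hn⟩ hmn

end KGraph

namespace GMor

open KGraph

variable {k : ℕ} {Λ : KGraph k}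

/-- A coherent family of paths is the family of initial segments of a graph morphism. -/
lemma exists_of_coherent (L : Fin k → ℕ∞) (P : (Fin k → ℕ) → Λ.Path)
    (hd : ∀ q : Fin k → ℕ, (∀ i, (q i : ℕ∞) ≤ L i) → Λ.d (P q) = q)
    (hP : ∀ p q : Fin k → ℕ, p ≤ q → (∀ i, (q i : ℕ∞) ≤ L i) → Λ.IsPrefix (P p) (P q)) :
    ∃ z : GMor Λ, z.len = L ∧ ∀ p q : Fin k → ℕ, p ≤ q → (∀ i, (q i : ℕ∞) ≤ L i) →
      Λ.s (P p) = Λ.r (z.seg p q) ∧ Λ.comp (P p) (z.seg p q) = P q := by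
  have : Nonempty Λ.Path := ⟨P 0⟩
  choose! T hTs hTc using hP
  have hmono : ∀ {p q : Fin k → ℕ}, p ≤ q → (∀ i, (q i : ℕ∞) ≤ L i) →
      ∀ i, (p i : ℕ∞) ≤ L i := fun h hq i => (Nat.cast_le.2 (h i)).trans (hq i)
  have hTT : ∀ p, (∀ i, (p i : ℕ∞) ≤ L i) → T p p = Λ.s (P p) := fun p hp =>
    comp_left_cancel (hTs p p le_rfl hp) (Λ.r_s _).symm
      (by rw [hTc p p le_rfl hp, Λ.comp_source])
  have hsT : ∀ p q, p ≤ q → (∀ i, (q i : ℕ∞) ≤ L i) → Λ.s (T p q) = Λ.s (P q) := by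
    intro p q hpq hq
    rw [← hTc p q hpq hq, Λ.s_comp _ _ (hTs p q hpq hq)]
  let sg : (Fin k → ℕ) → (Fin k → ℕ) → Λ.Path := fun p q =>
    if p ≤ q ∧ ∀ i, (q i : ℕ∞) ≤ L i then T p q else T 0 0
  have hsg : ∀ p q, p ≤ q → (∀ i, (q i : ℕ∞) ≤ L i) → sg p q = T p q :=
    fun p q h h' => if_pos ⟨h, h'⟩
  refine ⟨⟨L, sg, ?_, ?_, ?_, ?_, ?_⟩, rfl, ?_⟩
  · intro p q hpq hq
    rw [hsg p q hpq hq]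
    have e := congrArg Λ.d (hTc p q hpq hq)
    rw [Λ.d_comp _ _ (hTs p q hpq hq), hd q hq, hd p (hmono hpq hq)] at e
    exact eq_tsub_of_add_eq (by rw [add_comm, e])
  · intro p q hpq hq
    rw [hsg p q hpq hq, hsg p p le_rfl (hmono hpq hq), hTT p (hmono hpq hq), hTs p q hpq hq]
  · intro p q hpq hq
    rw [hsg p q hpq hq, hsg q q le_rfl hq, hTT q hq, hsT p q hpq hq]
  · intro p q u hpq hqu hu
    have hq := hmono hqu hu
    rw [hsg p q hpq hq, hsg q u hqu hu, hsg p u (hpq.trans hqu) hu]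
    have h1 : Λ.s (T p q) = Λ.r (T q u) := by rw [hsT p q hpq hq, hTs q u hqu hu]
    apply comp_left_cancel (a := P p) _ (hTs p u (hpq.trans hqu) hu)
    · rw [← Λ.comp_assoc _ _ _ (hTs p q hpq hq) h1, hTc p q hpq hq, hTc q u hqu hu,
        hTc p u (hpq.trans hqu) hu]
    · rw [Λ.r_comp _ _ h1, hTs p q hpq hq]
  · intro p q h
    rw [hsg 0 0 le_rfl (by simp)]
    exact if_neg h
  · intro p q hpq hq
    show Λ.s (P p) = Λ.r (sg p q) ∧ Λ.comp (P p) (sg p q) = P q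
    rw [hsg p q hpq hq]
    exact ⟨hTs p q hpq hq, hTc p q hpq hq⟩

/-- The restriction of a graph morphism to `Ω_{k,L}` for `L ≤ d(z)`. -/
lemma exists_agrees (z : GMor Λ) (L : Fin k → ℕ∞) (hL : ∀ i, L i ≤ z.len i) :
    ∃ y : GMor Λ, y.len = L ∧ z.Agrees y := by
  let sg : (Fin k → ℕ) → (Fin k → ℕ) → Λ.Path := fun p q =>
    if p ≤ q ∧ ∀ i, (q i : ℕ∞) ≤ L i then z.seg p q else z.seg 0 0
  have hsg : ∀ p q, p ≤ q → (∀ i, (q i : ℕ∞) ≤ L i) → sg p q = z.seg p q :=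
    fun p q h h' => if_pos ⟨h, h'⟩
  have hmono : ∀ {p q : Fin k → ℕ}, p ≤ q → (∀ i, (q i : ℕ∞) ≤ L i) →
      ∀ i, (p i : ℕ∞) ≤ L i := fun h hq i => (Nat.cast_le.2 (h i)).trans (hq i)
  refine ⟨⟨L, sg, ?_, ?_, ?_, ?_, ?_⟩, rfl, ?_⟩
  · intro p q hpq hq
    rw [hsg p q hpq hq]
    exact z.d_seg p q hpq fun i => (hq i).trans (hL i)
  · intro p q hpq hq
    rw [hsg p q hpq hq, hsg p p le_rfl (hmono hpq hq)]
    exact z.r_seg p q hpq fun i => (hq i).trans (hL i)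
  · intro p q hpq hq
    rw [hsg p q hpq hq, hsg q q le_rfl hq]
    exact z.s_seg p q hpq fun i => (hq i).trans (hL i)
  · intro p q u hpq hqu hu
    rw [hsg p q hpq (hmono hqu hu), hsg q u hqu hu, hsg p u (hpq.trans hqu) hu]
    exact z.comp_seg p q u hpq hqu fun i => (hu i).trans (hL i)
  · intro p q h
    rw [hsg 0 0 le_rfl (by simp)]
    exact if_neg h
  · intro p q hpq hq
    exact (hsg p q hpq hq).symm

lemma isPrefix_seg (x : GMor Λ) {m n : Fin k → ℕ} (hmn : m ≤ n)
    (hn : ∀ i, (n i : ℕ∞) ≤ x.len i) : Λ.IsPrefix (x.seg 0 m) (x.seg 0 n) := by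
  have hm : ∀ i, (m i : ℕ∞) ≤ x.len i := fun i => (Nat.cast_le.2 (hmn i)).trans (hn i)
  exact ⟨x.seg m n, by rw [x.s_seg 0 m zero_le hm, x.r_seg m n hmn hn],
    x.comp_seg 0 m n zero_le hmn hn⟩

lemma source_eq_r_seg (x : GMor Λ) {a : Λ.Path} (ha : Λ.s a = x.range) {n : Fin k → ℕ}
    (hn : ∀ i, (n i : ℕ∞) ≤ x.len i) : Λ.s a = Λ.r (x.seg 0 n) := by
  rw [ha, x.r_seg 0 n zero_le hn, range]

lemma d_comp_seg (x : GMor Λ) {a : Λ.Path} (ha : Λ.s a = x.range) {n : Fin k → ℕ}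
    (hn : ∀ i, (n i : ℕ∞) ≤ x.len i) : Λ.d (Λ.comp a (x.seg 0 n)) = Λ.d a + n := by
  rw [Λ.d_comp _ _ (x.source_eq_r_seg ha hn), x.d_seg 0 n zero_le hn, tsub_zero]

lemma isPrefix_comp_seg (x : GMor Λ) {a : Λ.Path} (ha : Λ.s a = x.range) {m n : Fin k → ℕ}
    (hmn : m ≤ n) (hn : ∀ i, (n i : ℕ∞) ≤ x.len i) :
    Λ.IsPrefix (Λ.comp a (x.seg 0 m)) (Λ.comp a (x.seg 0 n)) := by
  have hm : ∀ i, (m i : ℕ∞) ≤ x.len i := fun i => (Nat.cast_le.2 (hmn i)).trans (hn i)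
  have h := x.source_eq_r_seg ha hm
  obtain ⟨t, ht, htn⟩ := x.isPrefix_seg hmn hn
  exact ⟨t, by rw [Λ.s_comp _ _ h, ht], by rw [Λ.comp_assoc _ _ _ h ht, htn]⟩

/-- If the initial segments `P q` of `z` include all the paths `a x(0,n)`, then `z` restricts
to `ax`. -/
lemma exists_isExtension_agrees (x z : GMor Λ) (P : (Fin k → ℕ) → Λ.Path)
    (hP0 : Λ.d (P 0) = 0)
    (hz : ∀ p q : Fin k → ℕ, p ≤ q → (∀ i, (q i : ℕ∞) ≤ z.len i) →
      Λ.s (P p) = Λ.r (z.seg p q) ∧ Λ.comp (P p) (z.seg p q) = P q)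
    {a : Λ.Path} (ha : Λ.s a = x.range)
    (hlen : ∀ i, (Λ.d a i : ℕ∞) + x.len i ≤ z.len i)
    (hPa : ∀ n : Fin k → ℕ, (∀ i, (n i : ℕ∞) ≤ x.len i) →
      P (Λ.d a + n) = Λ.comp a (x.seg 0 n)) :
    ∃ y : GMor Λ, y.IsExtension a x ∧ z.Agrees y := by
  obtain ⟨y, hy, hzy⟩ := z.exists_agrees (fun i => (Λ.d a i : ℕ∞) + x.len i) hlen
  have hPd : P (Λ.d a) = a := by
    have h := hPa 0 (by simp)
    rwa [add_zero, show x.seg 0 0 = Λ.s a from ha.symm, Λ.comp_source] at h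
  refine ⟨y, ⟨fun i => by rw [hy], ?_, ?_⟩, hzy⟩
  · have h0 : ∀ i, (Λ.d a i : ℕ∞) ≤ y.len i := fun i => by rw [hy]; exact le_self_add
    rw [← hzy 0 (Λ.d a) zero_le h0]
    obtain ⟨h1, h2⟩ := hz 0 (Λ.d a) zero_le fun i => le_self_add.trans (hlen i)
    rw [← comp_of_d_eq_zero hP0 h1, h2, hPd]
  · intro n hn
    have hle : ∀ i, ((Λ.d a + n) i : ℕ∞) ≤ (Λ.d a i : ℕ∞) + x.len i := fun i => by
      rw [Pi.add_apply, Nat.cast_add]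
      exact add_le_add_right (hn i) _
    rw [← hzy (Λ.d a) (Λ.d a + n) le_self_add fun i => by rw [hy]; exact hle i]
    obtain ⟨h1, h2⟩ := hz (Λ.d a) (Λ.d a + n) le_self_add fun i => (hle i).trans (hlen i)
    rw [hPd] at h1 h2
    exact comp_left_cancel h1 (x.source_eq_r_seg ha hn) (by rw [h2, hPa n hn])

end GMor


/-- Lemma 6.3: if `x` is an aperiodic graph morphism and
`λ ≠ μ` with `s(λ) = s(μ) = r(x)`, then there is `n ≤ d(x)` with
`Λ^min(λ x(0,n), μ x(0,n)) = ∅`. -/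
theorem statement14 {k : ℕ} (Λ : KGraph k) (hΛ : Λ.FinitelyAligned)
    (x : GMor Λ) (hap : x.Aperiodic)
    (lam mu : Λ.Path) (hne : lam ≠ mu)
    (hl : Λ.s lam = x.range) (hm : Λ.s mu = x.range) :
    ∃ n : Fin k → ℕ, (∀ i, (n i : ℕ∞) ≤ x.len i) ∧
      Λ.Lmin (Λ.comp lam (x.seg 0 n)) (Λ.comp mu (x.seg 0 n)) = ∅ := by
  by_contra! hcon
  set D : Fin k → ℕ := Λ.d lam ⊔ Λ.d mu with hD
  let S : (Fin k → ℕ) → Set Λ.Path := fun n =>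
    {a | (∀ i, (n i : ℕ∞) ≤ x.len i) ∧ Λ.d a = D + n ∧
      Λ.IsPrefix (Λ.comp lam (x.seg 0 n)) a ∧ Λ.IsPrefix (Λ.comp mu (x.seg 0 n)) a}
  have hsup : ∀ n : Fin k → ℕ, (∀ i, (n i : ℕ∞) ≤ x.len i) →
      Λ.d (Λ.comp lam (x.seg 0 n)) ⊔ Λ.d (Λ.comp mu (x.seg 0 n)) = D + n := by
    intro n hn
    rw [x.d_comp_seg hl hn, x.d_comp_seg hm hn, hD]
    funext i
    simp only [Pi.sup_apply, Pi.add_apply]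
    omega
  obtain ⟨Z, hZS, hZ⟩ := KGraph.exists_coherent_paths x.len D S (fun n a ha => ha.2.1)
    (fun n => (hΛ (Λ.comp lam (x.seg 0 n)) (Λ.comp mu (x.seg 0 n))).subset
      fun a ha => ⟨by rw [hsup n ha.1, ha.2.1], ha.2.2.1.seg_eq, ha.2.2.2.seg_eq⟩)
    (by
      intro n hn
      obtain ⟨p, h1, h2, h3, h4⟩ := hcon n hn
      exact ⟨_, hn, h4.1.trans (hsup n hn), ⟨p.1, h1, rfl⟩, ⟨p.2, h2, h3.symm⟩⟩)
    (by
      intro m n hmn a b ⟨hn, _, hbl, hbm⟩ hab had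
      have hm' : ∀ i, (m i : ℕ∞) ≤ x.len i := fun i => (Nat.cast_le.2 (hmn i)).trans (hn i)
      have hs := hsup m hm'
      refine ⟨hm', had, ((x.isPrefix_comp_seg hl hmn hn).trans hbl).of_d_le hab ?_,
        ((x.isPrefix_comp_seg hm hmn hn).trans hbm).of_d_le hab ?_⟩
      · rw [had, ← hs]
        exact le_sup_left
      · rw [had, ← hs]
        exact le_sup_right)
  let P : (Fin k → ℕ) → Λ.Path := fun q => (Λ.split (Z (q - D)) q).1
  let L : Fin k → ℕ∞ := fun i => (D i : ℕ∞) + x.len i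
  have hsub : ∀ q : Fin k → ℕ, (∀ i, (q i : ℕ∞) ≤ L i) →
      ∀ i, ((q - D) i : ℕ∞) ≤ x.len i := by
    intro q hq i
    rw [Pi.sub_apply, ENat.natCast_sub]
    exact tsub_le_iff_left.2 (hq i)
  have hqZ : ∀ q : Fin k → ℕ, (∀ i, (q i : ℕ∞) ≤ L i) → q ≤ Λ.d (Z (q - D)) := by
    intro q hq
    rw [(hZS _ (hsub q hq)).2.1]
    exact le_add_tsub
  have hPd : ∀ q : Fin k → ℕ, (∀ i, (q i : ℕ∞) ≤ L i) → Λ.d (P q) = q :=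
    fun q hq => (KGraph.split_spec _ (hqZ q hq)).2.1
  have hPZ : ∀ q : Fin k → ℕ, (∀ i, (q i : ℕ∞) ≤ L i) → Λ.IsPrefix (P q) (Z (q - D)) :=
    fun q hq => KGraph.isPrefix_split _ (hqZ q hq)
  obtain ⟨z, hzL, hz⟩ := GMor.exists_of_coherent L P hPd (by
    intro p q hpq hq
    have hp : ∀ i, (p i : ℕ∞) ≤ L i := fun i => (Nat.cast_le.2 (hpq i)).trans (hq i)
    refine ((hPZ p hp).trans (hZ _ _ (tsub_le_tsub_right hpq D) (hsub q hq))).of_d_le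
      (hPZ q hq) ?_
    rwa [hPd p hp, hPd q hq])
  have hP0 : Λ.d (P 0) = 0 := hPd 0 (by simp)
  have hPa : ∀ a : Λ.Path, Λ.s a = x.range → Λ.d a ≤ D →
      (∀ n : Fin k → ℕ, (∀ i, (n i : ℕ∞) ≤ x.len i) →
        Λ.IsPrefix (Λ.comp a (x.seg 0 n)) (Z n)) →
      ∀ n : Fin k → ℕ, (∀ i, (n i : ℕ∞) ≤ x.len i) →
        P (Λ.d a + n) = Λ.comp a (x.seg 0 n) := by
    intro a ha haD haZ n hn
    have hle : ∀ i, ((Λ.d a + n) i : ℕ∞) ≤ z.len i := fun i => by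
      rw [hzL, Pi.add_apply, Nat.cast_add]
      exact add_le_add (Nat.cast_le.2 (haD i)) (hn i)
    have hsn : Λ.d a + n - D ≤ n := tsub_le_iff_left.2 (add_le_add_left haD n)
    rw [hzL] at hle
    exact ((hPZ _ hle).trans (hZ _ _ hsn hn)).eq_of_d_eq (haZ n hn)
      (by rw [hPd _ hle, x.d_comp_seg ha hn])
  have hlamD : Λ.d lam ≤ D := le_sup_left
  have hmuD : Λ.d mu ≤ D := le_sup_right
  obtain ⟨lx, hlx, hzlx⟩ := x.exists_isExtension_agrees z P hP0 (hzL ▸ hz) hl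
    (fun i => by rw [hzL]; exact add_le_add_left (Nat.cast_le.2 (hlamD i)) _)
    (hPa lam hl hlamD fun n hn => (hZS n hn).2.2.1)
  obtain ⟨mx, hmx, hzmx⟩ := x.exists_isExtension_agrees z P hP0 (hzL ▸ hz) hm
    (fun i => by rw [hzL]; exact add_le_add_left (Nat.cast_le.2 (hmuD i)) _)
    (hPa mu hm hmuD fun n hn => (hZS n hn).2.2.2)
  refine hap lam mu hne hl hm lx mx hlx hmx z ⟨fun i => ?_, hzlx, hzmx⟩
  rw [hzL, hlx.1, hmx.1, max_add_add_right]
  simp only [L, hD, Pi.sup_apply]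
  norm_cast
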